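/- Let X be a Rado complex with vertex set V(X) = ℕ, and suppose each vertex n ∈ ℕ is selected independently at random with probability p_n ∈ [0,1], where for some p > 0 one has p_n ≥ p for all n ∈ ℕ (i.e. consider the Bernoulli product measure on ω ∈ {0,1}^ℕ with ℙ(ω_n = 1) = p_n, independently). Let X_ω denote the subcomplex of X induced on the set of selected vertices {n : ω_n = 1}. Then X_ω is a Rado complex with probability 1. -/

import Mathlib

/-- An (abstract) simplicial complex with vertices drawn from `ℕ`:
a set of nonempty finite subsets of `ℕ` (the simplexes) closed under
passing to nonempty subsets.  The vertex set `V(X)` is the set of `v`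
with `{v}` a simplex. -/
structure SComplex where
  faces : Set (Finset ℕ)
  nonempty_of_mem : ∀ s ∈ faces, s.Nonempty
  down_closed : ∀ s ∈ faces, ∀ t ⊆ s, t.Nonempty → t ∈ faces

namespace SComplex

/-- The vertex set of a simplicial complex. -/
def vertexSet (X : SComplex) : Set ℕ := {v | {v} ∈ X.faces}

/-- The subcomplex of `X` induced on a set `U` of vertices. -/
def induced (X : SComplex) (U : Set ℕ) : SComplex where
  faces := {s | s ∈ X.faces ∧ (↑s : Set ℕ) ⊆ U}
  nonempty_of_mem := fun s hs => X.nonempty_of_mem s hs.1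
  down_closed := fun s hs t hts ht =>
    ⟨X.down_closed s hs.1 t hts ht,
     fun x hx => hs.2 (Finset.mem_coe.mpr (hts (Finset.mem_coe.mp hx)))⟩

/-- The link of a vertex `v`: all simplexes `σ` with `v ∉ σ` and `σ ∪ {v}` a simplex. -/
def link (X : SComplex) (v : ℕ) : SComplex where
  faces := {s | s ∈ X.faces ∧ v ∉ s ∧ insert v s ∈ X.faces}
  nonempty_of_mem := fun s hs => X.nonempty_of_mem s hs.1
  down_closed := fun s hs t hts ht =>
    ⟨X.down_closed s hs.1 t hts ht,
     fun hv => hs.2.1 (hts hv),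
     X.down_closed _ hs.2.2 _ (Finset.insert_subset_insert v hts)
       (Finset.insert_nonempty v t)⟩

/-- `IsIso X Y f` : the map `f` is an isomorphism of simplicial complexes from `X` to `Y`,
i.e. a bijection of the vertex sets which induces a bijection between the sets of simplexes. -/
def IsIso (X Y : SComplex) (f : ℕ → ℕ) : Prop :=
  Set.BijOn f X.vertexSet Y.vertexSet ∧
    ∀ s : Finset ℕ, (↑s : Set ℕ) ⊆ X.vertexSet → (s ∈ X.faces ↔ s.image f ∈ Y.faces)

/-- Two simplicial complexes are isomorphic. -/
def Isomorphic (X Y : SComplex) : Prop := ∃ f, IsIso X Y f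

/-- `X` is universal: every countable simplicial complex is isomorphic to an induced
subcomplex of `X`. -/
def Universal (X : SComplex) : Prop :=
  ∀ Y : SComplex, Y.vertexSet.Countable →
    ∃ U ⊆ X.vertexSet, Isomorphic Y (X.induced U)

/-- `X` is homogeneous: every isomorphism between finite induced subcomplexes of `X`
extends to an isomorphism of `X` onto itself. -/
def Homogeneous (X : SComplex) : Prop :=
  ∀ U U' : Set ℕ, U.Finite → U'.Finite → U ⊆ X.vertexSet → U' ⊆ X.vertexSet →
    ∀ f : ℕ → ℕ, IsIso (X.induced U) (X.induced U') f →
      ∃ F : ℕ → ℕ, IsIso X X F ∧ Set.EqOn F f U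

/-- A Rado complex: a countable simplicial complex which is universal and homogeneous. -/
def IsRado (X : SComplex) : Prop :=
  X.vertexSet.Countable ∧ Universal X ∧ Homogeneous X

/-- The ampleness condition: for every finite `U ⊆ V(X)` and every subcomplex `A` of the
induced complex `X_U` there is a vertex `v ∈ V(X) - U` with `Lk_X(v) ∩ X_U = A`. -/
def AmpleProp (X : SComplex) : Prop :=
  ∀ U : Set ℕ, U.Finite → U ⊆ X.vertexSet →
    ∀ A : SComplex, A.faces ⊆ (X.induced U).faces →
      ∃ v ∈ X.vertexSet \ U, (X.link v).faces ∩ (X.induced U).faces = A.faces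

/-- An ample complex: a countable simplicial complex satisfying the ampleness condition. -/
def IsAmple (X : SComplex) : Prop := X.vertexSet.Countable ∧ AmpleProp X

/-- `L'` is an induced subcomplex of `L`. -/
def IsInduced (L' L : SComplex) : Prop :=
  L'.faces ⊆ L.faces ∧ ∀ s ∈ L.faces, (↑s : Set ℕ) ⊆ L'.vertexSet → s ∈ L'.faces

end SComplex

/-- `IsBernoulli μ p` : `μ` is the Bernoulli product measure on `{0,1}^ℕ` in which
vertex `n` is selected (`ω n = true`) with probability `p n`, independently: `μ` is a
probability measure and the probability of any finite cylinder event is the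
corresponding product. -/
def IsBernoulli (μ : MeasureTheory.Measure (ℕ → Bool)) (p : ℕ → ℝ) : Prop :=
  MeasureTheory.IsProbabilityMeasure μ ∧
    ∀ (s : Finset ℕ) (b : ℕ → Bool),
      μ {ω | ∀ n ∈ s, ω n = b n} =
        ∏ n ∈ s, ENNReal.ofReal (if b n then p n else 1 - p n)

/-- The set of selected vertices of `ω`. -/
def selected (ω : ℕ → Bool) : Set ℕ := {n | ω n = true}

namespace SComplex

theorem vertexSet_induced (X : SComplex) (U : Set ℕ) :
    (X.induced U).vertexSet = X.vertexSet ∩ U := by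
  ext v
  simp [vertexSet, induced]

theorem coe_subset_vertexSet (X : SComplex) {s : Finset ℕ} (hs : s ∈ X.faces) :
    (↑s : Set ℕ) ⊆ X.vertexSet := fun v hv =>
  X.down_closed s hs {v} (by simpa using hv) (Finset.singleton_nonempty v)

/-- The complex obtained from the induced complex on `U` by adding a new vertex `w` with
link `A`. -/
def cone (X : SComplex) (U : Set ℕ) (A : SComplex) (w : ℕ) : SComplex where
  faces := {s | s.Nonempty ∧ ((s.erase w).Nonempty →
    s.erase w ∈ (X.induced U).faces ∧ (w ∈ s → s.erase w ∈ A.faces))}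
  nonempty_of_mem := fun s hs => hs.1
  down_closed := fun s hs t hts ht => by
    refine ⟨ht, fun hne => ?_⟩
    have hsub := Finset.erase_subset_erase w hts
    have h := hs.2 (hne.mono hsub)
    exact ⟨(X.induced U).down_closed _ h.1 _ hsub hne,
      fun hw => A.down_closed _ (h.2 (hts hw)) _ hsub hne⟩

theorem mem_cone_of_subset {X : SComplex} {U : Set ℕ} {A : SComplex} {w : ℕ} (hw : w ∉ U)
    {s : Finset ℕ} (hs : (↑s : Set ℕ) ⊆ U) : s ∈ (X.cone U A w).faces ↔ s ∈ X.faces := by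
  have hws : w ∉ s := fun h => hw (hs h)
  constructor
  · intro h
    have := h.2
    rw [Finset.erase_eq_of_notMem hws] at this
    exact (this h.1).1.1
  · intro h
    refine ⟨X.nonempty_of_mem s h, fun _ => ?_⟩
    rw [Finset.erase_eq_of_notMem hws]
    exact ⟨⟨h, hs⟩, fun h' => absurd h' hws⟩

theorem insert_mem_cone {X : SComplex} {U : Set ℕ} {A : SComplex} {w : ℕ} (hw : w ∉ U)
    (hA : A.faces ⊆ (X.induced U).faces) {s : Finset ℕ} (hs : (↑s : Set ℕ) ⊆ U)
    (hne : s.Nonempty) : insert w s ∈ (X.cone U A w).faces ↔ s ∈ A.faces := by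
  have hws : w ∉ s := fun h => hw (hs h)
  have he : (insert w s).erase w = s := Finset.erase_insert hws
  constructor
  · intro h
    have := h.2
    rw [he] at this
    exact (this hne).2 (Finset.mem_insert_self _ _)
  · intro h
    refine ⟨Finset.insert_nonempty _ _, fun _ => ?_⟩
    rw [he]
    exact ⟨hA h, fun _ => h⟩

theorem IsRado.ampleProp {X : SComplex} (hX : X.IsRado) : X.AmpleProp := by
  classical
  intro U hU hUV A hA
  obtain ⟨w, hw⟩ := hU.exists_notMem
  obtain ⟨W, -, g, hg, hgf⟩ := hX.2.1 (X.cone U A w) (Set.to_countable _)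
  have hwY : w ∈ (X.cone U A w).vertexSet :=
    ⟨Finset.singleton_nonempty w, fun h => by simp at h⟩
  have hUY : U ⊆ (X.cone U A w).vertexSet := fun x hx =>
    (mem_cone_of_subset hw (by simpa using hx)).2 (hUV hx)
  have hgX : ∀ s : Finset ℕ, (↑s : Set ℕ) ⊆ (X.cone U A w).vertexSet →
      (s ∈ (X.cone U A w).faces ↔ s.image g ∈ X.faces) := by
    intro s hs
    rw [hgf s hs]
    refine ⟨fun h => h.1, fun h => ⟨h, ?_⟩⟩
    rw [Finset.coe_image]
    rintro _ ⟨x, hx, rfl⟩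
    have := hg.mapsTo (hs hx)
    rw [vertexSet_induced] at this
    exact this.2
  have hgV : ∀ x ∈ (X.cone U A w).vertexSet, g x ∈ X.vertexSet := by
    intro x hx
    have := hg.mapsTo hx
    rw [vertexSet_induced] at this
    exact this.1
  have hinjU : Set.InjOn g U := hg.injOn.mono hUY
  have hinv : ∀ x ∈ U, Function.invFunOn g U (g x) = x := fun x hx =>
    hinjU.leftInvOn_invFunOn hx
  have hgU : g '' U ⊆ X.vertexSet := by
    rintro _ ⟨x, hx, rfl⟩
    exact hgV x (hUY hx)
  have himg : ∀ t : Finset ℕ, (↑t : Set ℕ) ⊆ U →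
      (t.image g).image (Function.invFunOn g U) = t := by
    intro t ht
    rw [Finset.image_image]
    conv_rhs => rw [← Finset.image_id (s := t)]
    exact Finset.image_congr fun x hx => hinv x (ht hx)
  obtain ⟨F, hF, hFE⟩ := hX.2.2 (g '' U) U (hU.image g) hU hgU hUV (Function.invFunOn g U) (by
    refine ⟨?_, ?_⟩
    · rw [vertexSet_induced, vertexSet_induced, Set.inter_eq_right.2 hgU,
        Set.inter_eq_right.2 hUV]
      refine ⟨?_, ?_, fun x hx => ⟨g x, ⟨x, hx, rfl⟩, hinv x hx⟩⟩
      · rintro _ ⟨x, hx, rfl⟩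
        rwa [hinv x hx]
      · rintro _ ⟨x, hx, rfl⟩ _ ⟨y, hy, rfl⟩ h
        rw [hinv x hx, hinv y hy] at h
        rw [h]
    · intro s hs
      rw [vertexSet_induced, Set.inter_eq_right.2 hgU] at hs
      obtain ⟨t, ht, rfl⟩ := Finset.subset_set_image_iff.1 hs
      rw [himg t ht]
      have h1 := hgX t (ht.trans hUY)
      rw [mem_cone_of_subset hw ht] at h1
      exact ⟨fun h => ⟨h1.2 h.1, ht⟩, fun h => ⟨h1.1 h.1, hs⟩⟩)
  have hFg : ∀ x ∈ U, F (g x) = x := fun x hx => by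
    rw [hFE ⟨x, hx, rfl⟩, hinv x hx]
  have hv : F (g w) ∉ U := by
    intro h
    have h1 := hF.1.injOn (hgV w hwY) (hgV _ (hUY h)) (hFg _ h).symm
    have h2 := hg.injOn hwY (hUY h) h1
    rw [← h2] at h
    exact hw h
  have key : ∀ s : Finset ℕ, (↑s : Set ℕ) ⊆ U → s.Nonempty →
      (insert (F (g w)) s ∈ X.faces ↔ s ∈ A.faces) := by
    intro s hs hne
    have hsY : (↑(insert w s) : Set ℕ) ⊆ (X.cone U A w).vertexSet := by
      rw [Finset.coe_insert]
      exact Set.insert_subset hwY (hs.trans hUY)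
    have hsX : (↑((insert w s).image g) : Set ℕ) ⊆ X.vertexSet := by
      rw [Finset.coe_image]
      rintro _ ⟨x, hx, rfl⟩
      exact hgV x (hsY hx)
    have him : ((insert w s).image g).image F = insert (F (g w)) s := by
      rw [Finset.image_image, Finset.image_insert]
      congr 1
      conv_rhs => rw [← Finset.image_id (s := s)]
      exact Finset.image_congr fun x hx => hFg x (hs hx)
    rw [← him, ← hF.2 _ hsX, ← hgX _ hsY, insert_mem_cone hw hA hs hne]
  refine ⟨F (g w), ⟨hF.1.mapsTo (hgV w hwY), hv⟩, ?_⟩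
  ext s
  constructor
  · rintro ⟨hl, hi⟩
    exact (key s hi.2 (X.nonempty_of_mem s hi.1)).1 hl.2.2
  · intro h
    have hi := hA h
    exact ⟨⟨hi.1, fun hm => hv (hi.2 hm), (key s hi.2 (X.nonempty_of_mem s hi.1)).2 h⟩, hi⟩

/-- `P` is the graph of an isomorphism between induced subcomplexes of `X` and `Y`. -/
structure IsPartialIso (X Y : SComplex) (P : Set (ℕ × ℕ)) : Prop where
  fst_mem : ∀ a ∈ P, a.1 ∈ X.vertexSet
  eq_iff : ∀ a ∈ P, ∀ b ∈ P, a.1 = b.1 ↔ a.2 = b.2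
  faces_iff : ∀ Q : Finset (ℕ × ℕ), (↑Q : Set (ℕ × ℕ)) ⊆ P →
    (Q.image Prod.fst ∈ X.faces ↔ Q.image Prod.snd ∈ Y.faces)

namespace IsPartialIso

variable {X Y : SComplex} {P : Set (ℕ × ℕ)}

theorem snd_mem (h : IsPartialIso X Y P) : ∀ a ∈ P, a.2 ∈ Y.vertexSet := fun a ha => by
  have := (h.faces_iff {a} (by simpa using ha)).1
    (by simpa using (show {a.1} ∈ X.faces from h.fst_mem a ha))
  simpa [vertexSet] using this

theorem swap (h : IsPartialIso X Y P) : IsPartialIso Y X (Prod.swap ⁻¹' P) where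
  fst_mem a ha := h.snd_mem _ ha
  eq_iff a ha b hb := (h.eq_iff _ ha _ hb).symm
  faces_iff Q hQ := by
    have := h.faces_iff (Q.image Prod.swap) (by
      rw [Finset.coe_image]
      rintro _ ⟨x, hx, rfl⟩
      exact hQ hx)
    rw [Finset.image_image, Finset.image_image] at this
    exact this.symm

theorem exists_extend (h : IsPartialIso X Y P) (hP : P.Finite) (hY : Y.AmpleProp) {x : ℕ}
    (hx : x ∈ X.vertexSet) :
    ∃ P', P ⊆ P' ∧ P'.Finite ∧ IsPartialIso X Y P' ∧ ∃ y, (x, y) ∈ P' := by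
  classical
  by_cases hxP : ∃ y, (x, y) ∈ P
  · exact ⟨P, subset_rfl, hP, h, hxP⟩
  push Not at hxP
  let A : SComplex :=
    { faces := {s | s.Nonempty ∧ ∃ Q : Finset (ℕ × ℕ), (↑Q : Set (ℕ × ℕ)) ⊆ P ∧
        Q.image Prod.snd = s ∧ insert x (Q.image Prod.fst) ∈ X.faces}
      nonempty_of_mem := fun s hs => hs.1
      down_closed := by
        rintro s ⟨-, Q, hQ, rfl, hf⟩ t hts ht
        obtain ⟨R, hR, rfl⟩ := Finset.subset_image_iff.1 hts
        exact ⟨ht, R, (Finset.coe_subset.2 hR).trans hQ, rfl, X.down_closed _ hf _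
          (Finset.insert_subset_insert _ (Finset.image_subset_image hR))
          (Finset.insert_nonempty _ _)⟩ }
  have hinj : Set.InjOn Prod.snd P := fun a ha b hb hab =>
    Prod.ext ((h.eq_iff a ha b hb).2 hab) hab
  obtain ⟨v, ⟨hvV, hvU⟩, hl⟩ := hY (Prod.snd '' P) (hP.image _)
    (by rintro _ ⟨a, ha, rfl⟩; exact h.snd_mem a ha) A (by
      rintro s ⟨hne, Q, hQ, rfl, hf⟩
      refine ⟨(h.faces_iff Q hQ).1 (X.down_closed _ hf _ (Finset.subset_insert _ _) ?_), ?_⟩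
      · exact (Finset.image_nonempty.1 hne).image _
      · rw [Finset.coe_image]
        exact Set.image_mono hQ)
  have hvP : ∀ a ∈ P, a.2 ≠ v := fun a ha e => hvU ⟨a, ha, e⟩
  have hxP' : ∀ a ∈ P, a.1 ≠ x := fun a ha e => hxP a.2 (by rw [← e]; exact ha)
  refine ⟨insert (x, v) P, Set.subset_insert _ _, hP.insert _, ⟨?_, ?_, ?_⟩, v,
    Set.mem_insert _ _⟩
  · rintro a (rfl | ha)
    · exact hx
    · exact h.fst_mem a ha
  · rintro a (rfl | ha) b (rfl | hb)
    · simp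
    · exact iff_of_false (hxP' b hb).symm (hvP b hb).symm
    · exact iff_of_false (hxP' a ha) (hvP a ha)
    · exact h.eq_iff a ha b hb
  · intro Q hQ
    by_cases hm : (x, v) ∈ Q
    swap
    · exact h.faces_iff Q ((Set.subset_insert_iff_of_notMem (by simpa using hm)).1 hQ)
    obtain ⟨R, hRn, rfl⟩ : ∃ R, (x, v) ∉ R ∧ insert (x, v) R = Q :=
      ⟨Q.erase (x, v), Finset.notMem_erase _ _, Finset.insert_erase hm⟩
    have hR : (↑R : Set (ℕ × ℕ)) ⊆ P := by
      rw [Finset.coe_insert] at hQ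
      exact (Set.subset_insert_iff_of_notMem (by simpa using hRn)).1
        ((Set.subset_insert _ _).trans hQ)
    rw [Finset.image_insert, Finset.image_insert]
    rcases R.eq_empty_or_nonempty with rfl | hne
    · exact iff_of_true (by simpa [vertexSet] using hx) (by simpa [vertexSet] using hvV)
    have hRU : (↑(R.image Prod.snd) : Set ℕ) ⊆ Prod.snd '' P := by
      rw [Finset.coe_image]
      exact Set.image_mono hR
    have hA : insert x (R.image Prod.fst) ∈ X.faces ↔ R.image Prod.snd ∈ A.faces := by
      refine ⟨fun hf => ⟨hne.image _, R, hR, rfl, hf⟩, ?_⟩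
      rintro ⟨-, Q', hQ', he, hf⟩
      have : Q' = R := by
        apply Finset.coe_injective
        apply (hinj.image_eq_image_iff hQ' hR).1
        rw [← Finset.coe_image, ← Finset.coe_image, he]
      rwa [← this]
    rw [hA, ← hl]
    refine ⟨fun hf => hf.1.2.2, fun hf => ?_⟩
    have hf' := Y.down_closed _ hf _ (Finset.subset_insert _ _) (hne.image _)
    exact ⟨⟨hf', fun hm => hvU (hRU hm), hf⟩, hf', hRU⟩

theorem exists_extend_snd (h : IsPartialIso X Y P) (hP : P.Finite) (hX : X.AmpleProp) {y : ℕ}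
    (hy : y ∈ Y.vertexSet) :
    ∃ P', P ⊆ P' ∧ P'.Finite ∧ IsPartialIso X Y P' ∧ ∃ x, (x, y) ∈ P' := by
  obtain ⟨P', hsub, hfin, hiso, x, hx⟩ := h.swap.exists_extend
    (hP.preimage Prod.swap_injective.injOn) hX hy
  exact ⟨Prod.swap ⁻¹' P', fun a ha => hsub (by simpa using ha),
    hfin.preimage Prod.swap_injective.injOn, hiso.swap, x, hx⟩

theorem iUnion_of_monotone {S : ℕ → Set (ℕ × ℕ)} (hS : Monotone S)
    (h : ∀ n, IsPartialIso X Y (S n)) : IsPartialIso X Y (⋃ n, S n) where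
  fst_mem a ha := by
    obtain ⟨n, hn⟩ := Set.mem_iUnion.1 ha
    exact (h n).fst_mem a hn
  eq_iff a ha b hb := by
    obtain ⟨n, hn⟩ := Set.mem_iUnion.1 ha
    obtain ⟨m, hm⟩ := Set.mem_iUnion.1 hb
    exact (h (max n m)).eq_iff a (hS (le_max_left _ _) hn) b (hS (le_max_right _ _) hm)
  faces_iff Q hQ := by
    obtain ⟨n, hn⟩ := hS.directed_le.exists_mem_subset_of_finset_subset_biUnion hQ
    exact (h n).faces_iff Q hn

/-- A finite partial isomorphism extends to one meeting countably many requirements, each of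
which can be met by a finite extension of any finite partial isomorphism. -/
theorem exists_generic (h : IsPartialIso X Y P) (hP : P.Finite)
    (D : ℕ → Set (ℕ × ℕ) → Prop) (hD : ∀ n, Monotone (D n))
    (step : ∀ n R, IsPartialIso X Y R → R.Finite →
      ∃ R', R ⊆ R' ∧ R'.Finite ∧ IsPartialIso X Y R' ∧ D n R') :
    ∃ R, P ⊆ R ∧ IsPartialIso X Y R ∧ ∀ n, D n R := by
  choose! next hsub hfin hiso hnext using step
  let S : ℕ → Set (ℕ × ℕ) := fun n => Nat.rec P (fun k R => next k R) n
  have hS : ∀ n, IsPartialIso X Y (S n) ∧ (S n).Finite := by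
    intro n
    induction n with
    | zero => exact ⟨h, hP⟩
    | succ n ih => exact ⟨hiso n _ ih.1 ih.2, hfin n _ ih.1 ih.2⟩
  have hmono : Monotone S := monotone_nat_of_le_succ fun n => hsub n _ (hS n).1 (hS n).2
  exact ⟨⋃ n, S n, Set.subset_iUnion S 0, iUnion_of_monotone hmono fun n => (hS n).1,
    fun n => hD n (Set.subset_iUnion S (n + 1)) (hnext n _ (hS n).1 (hS n).2)⟩

theorem isIso_induced_image (h : IsPartialIso X Y P) {f : ℕ → ℕ}
    (hf : ∀ x ∈ X.vertexSet, (x, f x) ∈ P) : IsIso X (Y.induced (f '' X.vertexSet)) f := by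
  have hV : f '' X.vertexSet ⊆ Y.vertexSet := by
    rintro _ ⟨x, hx, rfl⟩
    exact h.snd_mem _ (hf x hx)
  refine ⟨?_, fun s hs => ?_⟩
  · rw [vertexSet_induced, Set.inter_eq_right.2 hV]
    exact Set.InjOn.bijOn_image fun x hx y hy e => (h.eq_iff _ (hf x hx) _ (hf y hy)).2 e
  · have := h.faces_iff (s.image fun x => (x, f x)) (by
      rw [Finset.coe_image]
      rintro _ ⟨x, hx, rfl⟩
      exact hf x (hs hx))
    rw [Finset.image_image, Finset.image_image] at this
    have h1 : s.image (Prod.fst ∘ fun x => (x, f x)) = s := Finset.image_id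
    rw [h1] at this
    refine this.trans ⟨fun h' => ⟨h', ?_⟩, fun h' => h'.1⟩
    rw [Finset.coe_image]
    exact Set.image_mono hs

end IsPartialIso

theorem induced_vertexSet (X : SComplex) : X.induced X.vertexSet = X := by
  cases X with
  | mk faces h1 h2 =>
    simp only [induced, mk.injEq]
    ext s
    exact ⟨fun h => h.1, fun h => ⟨h, coe_subset_vertexSet ⟨faces, h1, h2⟩ h⟩⟩

theorem AmpleProp.universal {X : SComplex} (hX : X.AmpleProp) : X.Universal := by
  intro Y _
  have h0 : IsPartialIso Y X ∅ := by
    refine ⟨by simp, by simp, fun Q hQ => ?_⟩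
    have : Q = ∅ := by simpa using hQ
    subst this
    exact iff_of_false (fun h => by simpa using Y.nonempty_of_mem _ h)
      (fun h => by simpa using X.nonempty_of_mem _ h)
  obtain ⟨R, -, hR, hD⟩ := h0.exists_generic Set.finite_empty
    (fun n R => n ∈ Y.vertexSet → ∃ y, (n, y) ∈ R)
    (fun n R R' hRR' h hn => (h hn).imp fun y hy => hRR' hy) (by
      intro n R hR hfin
      by_cases hn : n ∈ Y.vertexSet
      · obtain ⟨R', h1, h2, h3, h4⟩ := hR.exists_extend hfin hX hn
        exact ⟨R', h1, h2, h3, fun _ => h4⟩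
      · exact ⟨R, subset_rfl, hfin, hR, fun h => absurd h hn⟩)
  choose! f hf using hD
  refine ⟨f '' Y.vertexSet, ?_, f, hR.isIso_induced_image hf⟩
  rintro _ ⟨x, hx, rfl⟩
  exact hR.snd_mem _ (hf x hx)

theorem IsIso.isPartialIso {X Y : SComplex} {U U' : Set ℕ} {f : ℕ → ℕ} (hU : U ⊆ X.vertexSet)
    (hU' : U' ⊆ Y.vertexSet) (hf : IsIso (X.induced U) (Y.induced U') f) :
    IsPartialIso X Y ((fun x => (x, f x)) '' U) := by
  obtain ⟨hb, hs⟩ := hf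
  rw [vertexSet_induced, vertexSet_induced, Set.inter_eq_right.2 hU,
    Set.inter_eq_right.2 hU'] at hb
  rw [vertexSet_induced, Set.inter_eq_right.2 hU] at hs
  refine ⟨?_, ?_, ?_⟩
  · rintro _ ⟨x, hx, rfl⟩
    exact hU hx
  · rintro _ ⟨x, hx, rfl⟩ _ ⟨y, hy, rfl⟩
    exact (hb.injOn.eq_iff hx hy).symm
  · intro Q hQ
    obtain ⟨t, ht, rfl⟩ := Finset.subset_set_image_iff.1 hQ
    rw [Finset.image_image, Finset.image_image]
    have h1 : t.image (Prod.fst ∘ fun x => (x, f x)) = t := Finset.image_id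
    have h2 : (↑(t.image f) : Set ℕ) ⊆ U' := by
      rw [Finset.coe_image]
      rintro _ ⟨x, hx, rfl⟩
      exact hb.mapsTo (ht hx)
    rw [h1]
    exact ⟨fun h => ((hs t ht).1 ⟨h, ht⟩).1, fun h => ((hs t ht).2 ⟨h, h2⟩).1⟩

theorem AmpleProp.homogeneous {X : SComplex} (hX : X.AmpleProp) : X.Homogeneous := by
  intro U U' hU _ hUV hUV' f hf
  obtain ⟨R, hPR, hR, hD⟩ := (hf.isPartialIso hUV hUV').exists_generic (hU.image _)
    (fun n R => n ∈ X.vertexSet → (∃ y, (n, y) ∈ R) ∧ ∃ x, (x, n) ∈ R)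
    (fun n R R' hRR' h hn =>
      ⟨(h hn).1.imp fun y hy => hRR' hy, (h hn).2.imp fun y hy => hRR' hy⟩) (by
      intro n R hR hfin
      by_cases hn : n ∈ X.vertexSet
      · obtain ⟨R₁, h1, h2, h3, y, hy⟩ := hR.exists_extend hfin hX hn
        obtain ⟨R₂, k1, k2, k3, k4⟩ := h3.exists_extend_snd h2 hX hn
        exact ⟨R₂, h1.trans k1, k2, k3, fun _ => ⟨⟨y, k1 hy⟩, k4⟩⟩
      · exact ⟨R, subset_rfl, hfin, hR, fun h => absurd h hn⟩)
  have hD1 := fun n hn => (hD n hn).1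
  choose! F hF using hD1
  have himg : F '' X.vertexSet = X.vertexSet := by
    ext y
    constructor
    · rintro ⟨x, hx, rfl⟩
      exact hR.snd_mem _ (hF x hx)
    · intro hy
      obtain ⟨x, hx⟩ := (hD y hy).2
      have hxV : x ∈ X.vertexSet := hR.fst_mem _ hx
      exact ⟨x, hxV, (hR.eq_iff _ (hF x hxV) _ hx).1 rfl⟩
  have hiso := hR.isIso_induced_image hF
  rw [himg, induced_vertexSet] at hiso
  exact ⟨F, hiso, fun x hx =>
    (hR.eq_iff _ (hF x (hUV hx)) _ (hPR ⟨x, hx, rfl⟩)).1 rfl⟩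

theorem AmpleProp.isRado {X : SComplex} (hX : X.AmpleProp) : X.IsRado :=
  ⟨Set.to_countable _, hX.universal, hX.homogeneous⟩

/-- The vertices outside `u` whose link meets the induced complex on `u` in `a`. -/
def extensionVertices (X : SComplex) (u : Finset ℕ) (a : Set (Finset ℕ)) : Set ℕ :=
  {v | v ∈ X.vertexSet \ ↑u ∧ (X.link v).faces ∩ (X.induced ↑u).faces = a}

theorem AmpleProp.infinite_extensionVertices {X : SComplex} (hX : X.AmpleProp) {u : Finset ℕ}
    (hu : (↑u : Set ℕ) ⊆ X.vertexSet) {A : SComplex} (hA : A.faces ⊆ (X.induced ↑u).faces) :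
    (X.extensionVertices u A.faces).Infinite := by
  intro hfin
  obtain ⟨v, ⟨hvV, hv⟩, hl⟩ := hX (↑u ∪ X.extensionVertices u A.faces)
    (u.finite_toSet.union hfin) (Set.union_subset hu fun v hv => hv.1.1) A
    (fun s hs => ⟨(hA hs).1, (hA hs).2.trans Set.subset_union_left⟩)
  refine hv (Or.inr ⟨⟨hvV, fun h => hv (Or.inl h)⟩, ?_⟩)
  ext s
  constructor
  · rintro ⟨h1, h2⟩
    rw [← hl]
    exact ⟨h1, h2.1, h2.2.trans Set.subset_union_left⟩
  · intro h
    exact ⟨(hl.symm.subset h).1, hA h⟩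

theorem AmpleProp.induced {X : SComplex} (hX : X.AmpleProp) {W : Set ℕ}
    (hW : ∀ (u : Finset ℕ) (a : Finset (Finset ℕ)), (X.extensionVertices u ↑a).Infinite →
      ∃ v ∈ X.extensionVertices u ↑a, v ∈ W) : (X.induced W).AmpleProp := by
  intro U hU hUV A hA
  rw [vertexSet_induced] at hUV
  lift U to Finset ℕ using hU
  have hA' : A.faces ⊆ (X.induced ↑U).faces := fun s hs => ⟨(hA hs).1.1, (hA hs).2⟩
  have hAfin : A.faces.Finite := U.powerset.finite_toSet.subset fun s hs => by
    simpa using (hA hs).2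
  have hinf := hX.infinite_extensionVertices (fun x hx => (hUV hx).1) hA'
  obtain ⟨v, ⟨⟨hvV, hvU⟩, hl⟩, hvW⟩ := hW U hAfin.toFinset (by simpa using hinf)
  rw [hAfin.coe_toFinset] at hl
  rw [vertexSet_induced]
  refine ⟨v, ⟨⟨hvV, hvW⟩, hvU⟩, ?_⟩
  rw [← hl]
  ext s
  constructor
  · rintro ⟨h1, h2⟩
    exact ⟨⟨h1.1.1, h1.2.1, h1.2.2.1⟩, h2.1.1, h2.2⟩
  · rintro ⟨h1, h2⟩
    have hsW : (↑s : Set ℕ) ⊆ W := fun x hx => (hUV (h2.2 hx)).2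
    refine ⟨⟨⟨h1.1, hsW⟩, h1.2.1, h1.2.2, ?_⟩, ⟨h1.1, hsW⟩, h2.2⟩
    rw [Finset.coe_insert]
    exact Set.insert_subset hvW hsW

end SComplex

open MeasureTheory Filter in
theorem IsBernoulli.ae_exists_mem_selected {μ : Measure (ℕ → Bool)} {p : ℕ → ℝ}
    (hμ : IsBernoulli μ p) {c : ℝ} (hc : 0 < c) (hcp : ∀ n, c ≤ p n) {S : Set ℕ}
    (hS : S.Infinite) : ∀ᵐ ω ∂μ, ∃ v ∈ S, v ∈ selected ω := by
  rw [ae_iff]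
  have hbound : ∀ k : ℕ, μ {ω | ¬∃ v ∈ S, v ∈ selected ω} ≤ ENNReal.ofReal (1 - c) ^ k := by
    intro k
    obtain ⟨s, hsS, rfl⟩ := hS.exists_subset_card_eq k
    calc μ {ω | ¬∃ v ∈ S, v ∈ selected ω}
        ≤ μ {ω | ∀ n ∈ s, ω n = false} := measure_mono fun ω hω n hn => by
          by_contra h
          exact hω ⟨n, hsS hn, by simpa [selected] using h⟩
      _ = ∏ n ∈ s, ENNReal.ofReal (1 - p n) := by simpa using hμ.2 s fun _ => false
      _ ≤ ∏ _n ∈ s, ENNReal.ofReal (1 - c) := by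
          gcongr with n
          exact hcp n
      _ = ENNReal.ofReal (1 - c) ^ s.card := Finset.prod_const _
  have hlim : Tendsto (fun k : ℕ => ENNReal.ofReal (1 - c) ^ k) atTop (nhds 0) :=
    ENNReal.tendsto_pow_atTop_nhds_zero_of_lt_one
      (by rw [ENNReal.ofReal_lt_one]; linarith)
  exact le_antisymm (ge_of_tendsto' hlim hbound) zero_le

/-- Let `X` be a Rado complex with vertex set all of `ℕ` and select
each vertex `n` independently with probability `p n`, where `p n ≥ c > 0` for all `n`.
Then the subcomplex induced on the selected vertices is a Rado complex almost surely. -/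
theorem random_induced_subcomplex_rado (X : SComplex) (hX : X.IsRado)
    (hV : X.vertexSet = Set.univ)
    (p : ℕ → ℝ) (hp : ∀ n, p n ∈ Set.Icc (0 : ℝ) 1)
    (c : ℝ) (hc : 0 < c) (hcp : ∀ n, c ≤ p n)
    (μ : MeasureTheory.Measure (ℕ → Bool)) (hμ : IsBernoulli μ p) :
    μ {ω | (X.induced (selected ω)).IsRado} = 1 := by
  have hprob := hμ.1
  have hample := hX.ampleProp
  have hae : ∀ᵐ ω ∂μ, (X.induced (selected ω)).IsRado := by
    have h : ∀ᵐ ω ∂μ, ∀ (u : Finset ℕ) (a : Finset (Finset ℕ)),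
        (X.extensionVertices u ↑a).Infinite →
          ∃ v ∈ X.extensionVertices u ↑a, v ∈ selected ω := by
      simp only [MeasureTheory.ae_all_iff]
      exact fun u a hS => hμ.ae_exists_mem_selected hc hcp hS
    filter_upwards [h] with ω hω
    exact (hample.induced hω).isRado
  rw [MeasureTheory.measure_congr (Filter.eventuallyEq_univ.2 hae),
    MeasureTheory.measure_univ]
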